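/- Let A be a local ring and let C be a homologically finite complex of A-modules having reducible complexity (as a complex in the derived category D(A)), and let n = sup C = sup { i : H_i(C) ≠ 0 }. Replacing C by a minimal complex of finitely generated free A-modules quasi-isomorphic to it, the A-module M = Coker(C_{n+1} → C_n) has reducible complexity. -/

import Mathlib

open IsLocalRing CategoryTheory

universe u

noncomputable section

/-! Basic commutative-algebra notions: depth, minimal free resolutions, Betti numbers,
complexity, syzygies, reducible complexity, upper reducing degree, Tor-independence,
Gorenstein dimension, CI-dimension, Cohen-Macaulay local rings. -/




/-- The depth of a module over a local ring: the supremum of lengths of regular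
sequences on the module consisting of elements of the maximal ideal. -/
def moduleDepth (A : Type u) [CommRing A] [IsLocalRing A]
    (M : Type u) [AddCommGroup M] [Module A M] : ℕ∞ :=
  sSup {n : ℕ∞ | ∃ rs : List A, (rs.length : ℕ∞) = n ∧
    (∀ x ∈ rs, x ∈ maximalIdeal A) ∧ RingTheory.Sequence.IsRegular M rs}

/-- A minimal free resolution of a module over a local ring. -/
structure MinFreeRes (A : Type u) [CommRing A] [IsLocalRing A]
    (M : Type u) [AddCommGroup M] [Module A M] : Type (u + 1) where
  F : ℕ → ModuleCat.{u} A
  free : ∀ n, Module.Free A (F n)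
  fin : ∀ n, Module.Finite A (F n)
  d : ∀ n, F (n + 1) →ₗ[A] F n
  aug : F 0 →ₗ[A] M
  aug_surj : Function.Surjective aug
  exact_aug : Function.Exact (d 0) aug
  exact_d : ∀ n, Function.Exact (d (n + 1)) (d n)
  minimal : ∀ n x, d n x ∈ (maximalIdeal A) • (⊤ : Submodule A (F n))

/-- The Betti numbers of a minimal free resolution. -/
def MinFreeRes.betti {A : Type u} [CommRing A] [IsLocalRing A]
    {M : Type u} [AddCommGroup M] [Module A M] (R : MinFreeRes A M) (n : ℕ) : ℕ :=
  Module.finrank A (R.F n)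

/-- The sequence `β` is eventually bounded by `a * n ^ (t - 1)` for some real `a`. -/
def CxBound (β : ℕ → ℕ) (t : ℕ) : Prop :=
  ∃ a : ℝ, ∃ N : ℕ, ∀ n, N ≤ n → (β n : ℝ) ≤ a * (n : ℝ) ^ ((t : ℝ) - 1)

/-- The complexity of a module: the least `t` such that the Betti sequence of a minimal
free resolution is eventually bounded by `a * n ^ (t - 1)` for some `a` (and `⊤` if no
such `t` exists). -/
def complexity (A : Type u) [CommRing A] [IsLocalRing A]
    (M : Type u) [AddCommGroup M] [Module A M] : ℕ∞ :=
  sInf {t : ℕ∞ | ∃ t' : ℕ, t = (t' : ℕ∞) ∧ ∃ R : MinFreeRes A M, CxBound R.betti t'}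

/-- A finite resolution of a module `M`:
an exact sequence `0 → G len → ⋯ → G 0 → M → 0`. -/
structure FinRes (A : Type u) [CommRing A]
    (M : Type u) [AddCommGroup M] [Module A M] : Type (u + 1) where
  len : ℕ
  G : ℕ → ModuleCat.{u} A
  d : ∀ n, G (n + 1) →ₗ[A] G n
  aug : G 0 →ₗ[A] M
  bounded : ∀ n, len < n → Subsingleton (G n)
  aug_surj : Function.Surjective aug
  exact_aug : Function.Exact (d 0) aug
  exact_d : ∀ n, Function.Exact (d (n + 1)) (d n)

/-- A module has finite projective dimension if it admits a finite resolution by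
projective modules. -/
def HasFiniteProjDim (A : Type u) [CommRing A]
    (M : Type u) [AddCommGroup M] [Module A M] : Prop :=
  ∃ R : FinRes A M, ∀ n, Module.Projective A (R.G n)

/-- `S` is an `n`-th syzygy of `M`: for `n = 0`, `S ≅ M`; for `n ≥ 1`, `S` is isomorphic to
the image of the `n`-th differential in a minimal free resolution of `M`. -/
def IsSyzygy (A : Type u) [CommRing A] [IsLocalRing A]
    (M : Type u) [AddCommGroup M] [Module A M]
    (S : Type u) [AddCommGroup S] [Module A S] : ℕ → Prop
  | 0 => Nonempty (S ≃ₗ[A] M)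
  | (n + 1) => ∃ R : MinFreeRes A M, Nonempty (S ≃ₗ[A] LinearMap.range (R.d n))

/-- `K` is obtained from `M` by a reduction of complexity coming from a cohomology class
of degree `t ≥ 1`, i.e. there is a short exact sequence `0 → M → K → Ω^{t-1}(M) → 0`. -/
def ReducesWithDeg (A : Type u) [CommRing A] [IsLocalRing A]
    (M K : ModuleCat.{u} A) (t : ℕ) : Prop :=
  1 ≤ t ∧ ∃ (S : Type u) (_ : AddCommGroup S) (_ : Module A S),
    IsSyzygy A M S (t - 1) ∧
    ∃ (f : M →ₗ[A] K) (g : K →ₗ[A] S),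
      Function.Injective f ∧ Function.Surjective g ∧ Function.Exact f g

/-- The class of (bundled) modules having reducible complexity: the smallest class
containing all modules of finite projective dimension, and containing every module `M` of
finite positive complexity admitting a short exact sequence
`0 → M → K → Ω^{t-1}(M) → 0` (coming from a degree-`t` self-extension) with
`cx K < cx M` and `K` of reducible complexity. -/
inductive HasRedCxCat (A : Type u) [CommRing A] [IsLocalRing A] : ModuleCat.{u} A → Prop
  | of_finite_pd (M : ModuleCat.{u} A) : HasFiniteProjDim A M → HasRedCxCat A M
  | of_step (M K : ModuleCat.{u} A) (t : ℕ) :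
      complexity A M ≠ 0 → complexity A M ≠ ⊤ →
      ReducesWithDeg A M K t →
      complexity A K < complexity A M →
      HasRedCxCat A K → HasRedCxCat A M

/-- A module has reducible complexity. -/
def HasReducibleComplexity (A : Type u) [CommRing A] [IsLocalRing A]
    (M : Type u) [AddCommGroup M] [Module A M] : Prop :=
  HasRedCxCat A (ModuleCat.of A M)

/-- A sequence of short exact sequences `0 → K_{i-1} → K_i → Ω^{d_i - 1}(K_{i-1}) → 0`
with strictly decreasing complexities, ending in a module of complexity zero, i.e. a
sequence reducing the complexity of `Ks 0`. -/
def IsReducingSeq (A : Type u) [CommRing A] [IsLocalRing A] (t : ℕ)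
    (Ks : Fin (t + 1) → ModuleCat.{u} A) (degs : Fin t → ℕ) : Prop :=
  (∀ i : Fin t, ReducesWithDeg A (Ks i.castSucc) (Ks i.succ) (degs i)) ∧
  (∀ i : Fin t, complexity A (Ks i.succ) < complexity A (Ks i.castSucc)) ∧
  complexity A (Ks (Fin.last t)) = 0

open Classical in
/-- The upper reducing degree of `M`: `⊤` if `M` has finite projective dimension, and
otherwise the supremum, over all sequences reducing the complexity of `M`, of the minimum
of the degrees of the cohomology classes involved. -/
def upperReducingDegree (A : Type u) [CommRing A] [IsLocalRing A]
    (M : Type u) [AddCommGroup M] [Module A M] : ℕ∞ :=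
  if HasFiniteProjDim A M then ⊤
  else sSup {r : ℕ∞ | ∃ (t : ℕ) (Ks : Fin (t + 1) → ModuleCat.{u} A) (degs : Fin t → ℕ),
    Ks 0 = ModuleCat.of A M ∧ IsReducingSeq A t Ks degs ∧
    r = ⨅ i : Fin t, (degs i : ℕ∞)}

/-- The `n`-th Tor module of two modules. -/
def torModule (A : Type u) [CommRing A] (M N : Type u)
    [AddCommGroup M] [Module A M] [AddCommGroup N] [Module A N] (n : ℕ) : ModuleCat.{u} A :=
  ((Tor (ModuleCat.{u} A) n).obj (ModuleCat.of A M)).obj (ModuleCat.of A N)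

/-- Two modules are Tor-independent if `Tor_n(M, N) = 0` for all `n > 0`. -/
def TorIndep (A : Type u) [CommRing A] (M N : Type u)
    [AddCommGroup M] [Module A M] [AddCommGroup N] [Module A N] : Prop :=
  ∀ n : ℕ, 0 < n → Subsingleton (torModule A M N n)

/-- The `n`-th Ext module of two modules. -/
def extModule (A : Type u) [CommRing A] (M N : Type u)
    [AddCommGroup M] [Module A M] [AddCommGroup N] [Module A N] (n : ℕ) : ModuleCat.{u} A :=
  ((Ext A (ModuleCat.{u} A) n).obj (Opposite.op (ModuleCat.of A M))).obj (ModuleCat.of A N)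

/-- A module `G` has Gorenstein dimension zero if it is reflexive and
`Ext^n(G, A) = 0 = Ext^n(Hom(G, A), A)` for all `n > 0`. -/
def GDimZero (A : Type u) [CommRing A] (G : Type u) [AddCommGroup G] [Module A G] : Prop :=
  Module.IsReflexive A G ∧
  ∀ n : ℕ, 0 < n →
    Subsingleton (extModule A G A n) ∧ Subsingleton (extModule A (Module.Dual A G) A n)

/-- A module has finite Gorenstein dimension if it admits a finite resolution by modules
of Gorenstein dimension zero. -/
def HasFiniteGDim (A : Type u) [CommRing A]
    (M : Type u) [AddCommGroup M] [Module A M] : Prop :=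
  ∃ R : FinRes A M, ∀ n, GDimZero A (R.G n)


/-- The Krull dimension of a ring, viewed in `WithBot ℕ∞`. -/
def ringKrullDimE (A : Type u) [CommRing A] : WithBot ℕ∞ := ringKrullDim A

/-- A local ring is Cohen-Macaulay if its depth equals its Krull dimension. -/
def IsCMLocalRing (A : Type u) [CommRing A] [IsLocalRing A] : Prop :=
  (moduleDepth A A : WithBot ℕ∞) = ringKrullDimE A

/-- A module over a local ring is maximal Cohen-Macaulay if its depth equals the Krull
dimension of the ring. -/
def IsMaxCM (A : Type u) [CommRing A] [IsLocalRing A]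
    (M : Type u) [AddCommGroup M] [Module A M] : Prop :=
  (moduleDepth A M : WithBot ℕ∞) = ringKrullDimE A

/-- A local ring is Gorenstein if and only if every finitely generated module over it has
finite Gorenstein dimension. -/
def IsGorensteinLocalRing (A : Type u) [CommRing A] [IsLocalRing A] : Prop :=
  ∀ M : ModuleCat.{u} A, Module.Finite A M → HasFiniteGDim A M

/-- A module `M` over a local ring `A` has finite CI-dimension if there is a diagram of
local ring homomorphisms `A → R ← Q` with `A → R` flat and `Q → R` surjective with kernel
generated by a regular sequence, such that `R ⊗_A M` has finite projective dimension
over `Q`. -/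
def HasFiniteCIDimMod (A : Type u) [CommRing A] [IsLocalRing A]
    (M : Type u) [AddCommGroup M] [Module A M] : Prop :=
  ∃ (R Q : Type u) (_ : CommRing R) (_ : CommRing Q) (_ : IsLocalRing R) (_ : IsLocalRing Q)
    (f : A →+* R) (g : Q →+* R),
    IsLocalHom f ∧ IsLocalHom g ∧ Function.Surjective g ∧
    (∃ rs : List Q, RingTheory.Sequence.IsRegular Q rs ∧
      RingHom.ker g = Ideal.span {x | x ∈ rs}) ∧
    (letI : Algebra A R := f.toAlgebra
     Module.Flat A R ∧
     (letI : Module Q (TensorProduct A R M) := Module.compHom _ g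
      HasFiniteProjDim Q (TensorProduct A R M)))





/-- A (ℤ-indexed) chain complex of `A`-modules, with differentials of degree `-1`
recorded, Mathlib-style, as a family of maps `d i j : X i → X j` vanishing
unless `j + 1 = i`. -/
structure Cx (A : Type u) [CommRing A] : Type (u + 1) where
  X : ℤ → ModuleCat.{u} A
  d : ∀ i j : ℤ, X i →ₗ[A] X j
  shape : ∀ i j : ℤ, j + 1 ≠ i → d i j = 0
  dsq : ∀ i j k : ℤ, (d j k).comp (d i j) = 0

/-- A chain map between complexes. -/
structure CxHom {A : Type u} [CommRing A] (C D : Cx A) : Type u where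
  f : ∀ i : ℤ, C.X i →ₗ[A] D.X i
  comm : ∀ i j : ℤ, (D.d i j).comp (f i) = (f j).comp (C.d i j)

variable {A : Type u} [CommRing A]

/-- The `n`-th suspension `Σ^n C` of a complex: `(Σ^n C)_i = C_{i-n}`, with differential
multiplied by `(-1)^n`. -/
def Cx.shift (C : Cx A) (n : ℕ) : Cx A where
  X i := C.X (i - n)
  d i j := ((-1 : A) ^ n) • C.d (i - n) (j - n)
  shape i j h := by
    have : (j : ℤ) - n + 1 ≠ i - n := by omega
    show ((-1 : A) ^ n) • C.d (i - n) (j - n) = 0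
    rw [C.shape _ _ this, smul_zero]
  dsq i j k := by
    ext x
    simp only [LinearMap.comp_apply, LinearMap.smul_apply, LinearMap.zero_apply, map_smul]
    rw [← LinearMap.comp_apply (C.d (j - n) (k - n)), C.dsq]
    simp

/-- The cycles of a complex in degree `i`. -/
def Cx.cycles (C : Cx A) (i : ℤ) : Submodule A (C.X i) := LinearMap.ker (C.d i (i - 1))

/-- The boundaries of a complex in degree `i`. -/
def Cx.bnd (C : Cx A) (i : ℤ) : Submodule A (C.X i) := LinearMap.range (C.d (i + 1) i)

/-- The homology of a complex in degree `i`. -/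
def Cx.homology (C : Cx A) (i : ℤ) : Type u :=
  C.cycles i ⧸ ((C.bnd i).comap (C.cycles i).subtype)

instance (C : Cx A) (i : ℤ) : AddCommGroup (C.homology i) :=
  inferInstanceAs (AddCommGroup (C.cycles i ⧸ ((C.bnd i).comap (C.cycles i).subtype)))

instance (C : Cx A) (i : ℤ) : Module A (C.homology i) :=
  inferInstanceAs (Module A (C.cycles i ⧸ ((C.bnd i).comap (C.cycles i).subtype)))

/-- The map induced on homology by a chain map. -/
def CxHom.homologyMap {C D : Cx A} (φ : CxHom C D) (i : ℤ) :
    C.homology i →ₗ[A] D.homology i := by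
  refine Submodule.mapQ _ _ ((φ.f i).restrict (p := C.cycles i) (q := D.cycles i) ?_) ?_
  · intro x hx
    have h := congrArg (fun ψ => ψ x) (φ.comm i (i - 1))
    simp only [LinearMap.comp_apply] at h
    simp only [Cx.cycles, LinearMap.mem_ker] at hx ⊢
    rw [h, hx, map_zero]
  · rintro ⟨x, hx⟩ hmem
    simp only [Submodule.mem_comap, Submodule.subtype_apply] at hmem ⊢
    obtain ⟨y, hy⟩ := hmem
    have h := congrArg (fun ψ => ψ y) (φ.comm (i + 1) i)
    simp only [LinearMap.comp_apply] at h
    refine ⟨φ.f (i + 1) y, ?_⟩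
    rw [h, hy]
    rfl

/-- A chain map is a quasi-isomorphism if it induces isomorphisms on all homology. -/
def CxHom.IsQuasiIso {C D : Cx A} (φ : CxHom C D) : Prop :=
  ∀ i : ℤ, Function.Bijective (φ.homologyMap i)

/-- A complex is homologically finite if its homology is bounded and degreewise
finitely generated. -/
def Cx.HomFinite (C : Cx A) : Prop :=
  (∃ a b : ℤ, ∀ i, (i < a ∨ b < i) → Subsingleton (C.homology i)) ∧
  ∀ i, Module.Finite A (C.homology i)

/-- A bounded below, degreewise finitely generated free complex which is minimal
(the differentials map into `m` times the next module). -/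
def Cx.IsMinFree [IsLocalRing A] (C : Cx A) : Prop :=
  (∃ n₀ : ℤ, ∀ i, i < n₀ → Subsingleton (C.X i)) ∧
  (∀ i, Module.Free A (C.X i) ∧ Module.Finite A (C.X i)) ∧
  (∀ i j (x : C.X i), C.d i j x ∈ (maximalIdeal A) • (⊤ : Submodule A (C.X j)))

/-- `F` is a minimal free resolution of the complex `C`. -/
def IsMinFreeResCx [IsLocalRing A] (F C : Cx A) : Prop :=
  F.IsMinFree ∧ ∃ φ : CxHom F C, φ.IsQuasiIso

/-- A perfect complex: a bounded complex of finitely generated projective modules. -/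
def Cx.IsPerfect (C : Cx A) : Prop :=
  (∃ a b : ℤ, ∀ i, (i < a ∨ b < i) → Subsingleton (C.X i)) ∧
  ∀ i, Module.Finite A (C.X i) ∧ Module.Projective A (C.X i)

/-- A complex has finite projective dimension if it is quasi-isomorphic to a perfect
complex. -/
def Cx.HasFinitePD (C : Cx A) : Prop :=
  ∃ P : Cx A, P.IsPerfect ∧ ∃ φ : CxHom P C, φ.IsQuasiIso

/-- `K` is (isomorphic to) the mapping cone of the chain map `g : C → D`:
there are maps `ι : D → K` and `π : K → ΣC` exhibiting a degreewise split short exact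
sequence `0 → D → K → ΣC → 0`, via a degreewise splitting `s`, such that the
differential of `K` restricted along `s` is given by `g` (up to the sign conventions of
the cone construction). -/
def IsConeOf {A : Type u} [CommRing A] {C D : Cx A} (g : CxHom C D) (K : Cx A) : Prop :=
  ∃ (ι : ∀ i : ℤ, D.X i →ₗ[A] K.X i) (π : ∀ i : ℤ, K.X i →ₗ[A] C.X (i - 1))
    (s : ∀ i : ℤ, C.X (i - 1) →ₗ[A] K.X i),
    (∀ i j : ℤ, (K.d i j).comp (ι i) = (ι j).comp (D.d i j)) ∧
    (∀ i j : ℤ, (π j).comp (K.d i j) = (-1 : A) • ((C.d (i - 1) (j - 1)).comp (π i))) ∧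
    (∀ i, Function.Injective (ι i)) ∧
    (∀ i, (π i).comp (ι i) = 0) ∧
    (∀ i, (π i).comp (s i) = LinearMap.id) ∧
    (∀ i (x : K.X i), ∃ y, x = ι i y + s i (π i x)) ∧
    (∀ i (c : C.X (i - 1)),
      K.d i (i - 1) (s i c) = ι (i - 1) (g.f (i - 1) c) - s (i - 1) (C.d (i - 1) (i - 1 - 1) c))

/-- The complexity of a homologically finite complex: the least `t` such that the Betti
sequence (the ranks of the modules in a minimal free resolution) is eventually bounded by
`a * n ^ (t - 1)` for some `a`. -/
def cxComplexity (A : Type u) [CommRing A] [IsLocalRing A] (C : Cx A) : ℕ∞ :=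
  sInf {t : ℕ∞ | ∃ t' : ℕ, t = (t' : ℕ∞) ∧ ∃ F : Cx A, IsMinFreeResCx F C ∧
    CxBound (fun n => Module.finrank A (F.X (n : ℤ))) t'}

/-- The class of complexes having reducible complexity: the smallest class of
homologically finite complexes containing the complexes of finite projective dimension,
and containing every complex `C` of finite positive complexity admitting a triangle
`C → Σ^n C → K → Σ C` with `n > 0`, `cx K < cx C` and `K` of reducible complexity.
(The triangle is realized by taking the mapping cone of a chain map `F → Σ^n F` for a
minimal free resolution `F` of `C`.) -/
inductive CxRedCx (A : Type u) [CommRing A] [IsLocalRing A] : Cx A → Prop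
  | of_finite_pd (C : Cx A) : C.HasFinitePD → CxRedCx A C
  | of_step (C : Cx A) (n : ℕ) (F : Cx A) (g : CxHom F (F.shift n)) (K : Cx A) :
      0 < n →
      cxComplexity A C ≠ 0 → cxComplexity A C ≠ ⊤ →
      IsMinFreeResCx F C →
      IsConeOf g K →
      cxComplexity A K < cxComplexity A C →
      CxRedCx A K → CxRedCx A C

/-- The base change of a complex of `A`-modules along `A → R`. -/
def Cx.baseChange {A : Type u} [CommRing A] (R : Type u) [CommRing R] [Algebra A R]
    (C : Cx A) : Cx R where
  X i := ModuleCat.of R (TensorProduct A R (C.X i))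
  d i j := (C.d i j).baseChange R
  shape i j h := by
    show (C.d i j).baseChange R = 0
    rw [C.shape i j h, LinearMap.baseChange_zero]
  dsq i j k := by
    show ((C.d j k).baseChange R).comp ((C.d i j).baseChange R) = 0
    rw [← LinearMap.baseChange_comp, C.dsq, LinearMap.baseChange_zero]

/-- The restriction of scalars of a complex of `R`-modules along a ring map `Q → R`. -/
def Cx.restrict {R : Type u} [CommRing R] {Q : Type u} [CommRing Q] (g : Q →+* R)
    (D : Cx R) : Cx Q :=
  letI : ∀ i, Module Q (D.X i) := fun i => Module.compHom _ g
  { X := fun i => ModuleCat.of Q (D.X i)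
    d := fun i j =>
      { toFun := D.d i j
        map_add' := (D.d i j).map_add
        map_smul' := fun q x => (D.d i j).map_smul (g q) x }
    shape := fun i j h => by
      ext x
      show D.d i j x = 0
      rw [D.shape i j h]
      rfl
    dsq := fun i j k => by
      ext x
      show D.d j k (D.d i j x) = 0
      rw [← LinearMap.comp_apply, D.dsq]
      rfl }

/-- A complex `C` over a local ring `A` has finite CI-dimension if there is a diagram of
local ring homomorphisms `A → R ← Q` with `A → R` flat and `Q → R` surjective with kernel
generated by a regular sequence, such that `R ⊗_A C` has finite projective dimension as a
complex of `Q`-modules. -/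
def Cx.HasFiniteCIDim (A : Type u) [CommRing A] [IsLocalRing A] (C : Cx A) : Prop :=
  ∃ (R Q : Type u) (_ : CommRing R) (_ : CommRing Q) (_ : IsLocalRing R) (_ : IsLocalRing Q)
    (f : A →+* R) (g : Q →+* R),
    IsLocalHom f ∧ IsLocalHom g ∧ Function.Surjective g ∧
    (∃ rs : List Q, RingTheory.Sequence.IsRegular Q rs ∧
      RingHom.ker g = Ideal.span {x | x ∈ rs}) ∧
    (letI : Algebra A R := f.toAlgebra
     Module.Flat A R ∧ ((C.baseChange R).restrict g).HasFinitePD)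

/-- The complex `F` is a resolution of the module `M`: it vanishes in negative degrees,
is exact in positive degrees, and has `H₀ ≅ M` via an augmentation map. -/
def IsResolutionOfModule {A : Type u} [CommRing A] (F : Cx A)
    (M : Type u) [AddCommGroup M] [Module A M] : Prop :=
  (∀ i : ℤ, i < 0 → Subsingleton (F.X i)) ∧
  ∃ aug : F.X 0 →ₗ[A] M, Function.Surjective aug ∧ Function.Exact (F.d 1 0) aug ∧
    ∀ i : ℤ, 1 ≤ i → Function.Exact (F.d (i + 1) i) (F.d i (i - 1))

/-- The complex `F` is a free resolution of the module `M`. -/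
def IsFreeResolutionOfModule {A : Type u} [CommRing A] (F : Cx A)
    (M : Type u) [AddCommGroup M] [Module A M] : Prop :=
  IsResolutionOfModule F M ∧ ∀ i, Module.Free A (F.X i) ∧ Module.Finite A (F.X i)

/-! ### Complexes: elementwise descriptions -/

theorem Cx.d_d (C : Cx A) (i j k : ℤ) (x : C.X i) : C.d j k (C.d i j x) = 0 :=
  LinearMap.congr_fun (C.dsq i j k) x

theorem CxHom.comm_apply {C D : Cx A} (φ : CxHom C D) (i j : ℤ) (x : C.X i) :
    D.d i j (φ.f i x) = φ.f j (C.d i j x) :=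
  LinearMap.congr_fun (φ.comm i j) x

/-- A chain map is determined by its components and their compatibility with the
differentials in the single relevant degree. -/
def CxHom.mk' {C D : Cx A} (f : ∀ i : ℤ, C.X i →ₗ[A] D.X i)
    (h : ∀ i x, D.d (i + 1) i (f (i + 1) x) = f i (C.d (i + 1) i x)) : CxHom C D where
  f := f
  comm i j := by
    by_cases hij : j + 1 = i
    · subst hij
      exact LinearMap.ext fun x => h j x
    · rw [C.shape i j hij, D.shape i j hij]
      simp

/-- The identity chain map. -/
def CxHom.id (C : Cx A) : CxHom C C where
  f _ := LinearMap.id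
  comm _ _ := rfl

theorem Cx.subsingleton_homology_iff (C : Cx A) (i : ℤ) :
    Subsingleton (C.homology i) ↔
      ∀ x, C.d i (i - 1) x = 0 → ∃ y, C.d (i + 1) i y = x := by
  rw [Cx.homology, Submodule.Quotient.subsingleton_iff, eq_top_iff]
  constructor
  · intro h x hx
    exact h (x := ⟨x, hx⟩) trivial
  · rintro h ⟨x, hx⟩ -
    exact h x hx

theorem Cx.exists_d_eq {C : Cx A} {j : ℤ} (h : Subsingleton (C.homology j)) {i k : ℤ}
    (hi : i = j + 1) (hk : k = j - 1) {x : C.X j} (hx : C.d j k x = 0) :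
    ∃ y, C.d i j y = x := by
  subst hi hk
  exact (C.subsingleton_homology_iff j).1 h x hx

theorem CxHom.homologyMap_mk {C D : Cx A} (φ : CxHom C D) (i : ℤ) (x : C.X i)
    (hx : x ∈ C.cycles i) (hx' : φ.f i x ∈ D.cycles i) :
    φ.homologyMap i (Submodule.Quotient.mk ⟨x, hx⟩) = Submodule.Quotient.mk ⟨φ.f i x, hx'⟩ :=
  rfl

theorem CxHom.mem_cycles {C D : Cx A} (φ : CxHom C D) {i : ℤ} {x : C.X i}
    (hx : x ∈ C.cycles i) : φ.f i x ∈ D.cycles i := by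
  have hx' : C.d i (i - 1) x = 0 := hx
  change D.d i (i - 1) (φ.f i x) = 0
  rw [φ.comm_apply, hx', map_zero]

/-- Injectivity and surjectivity on homology, in terms of elements. -/
theorem CxHom.isQuasiIso_iff {C D : Cx A} (φ : CxHom C D) :
    φ.IsQuasiIso ↔
      (∀ i x, C.d i (i - 1) x = 0 → (∃ c, φ.f i x = D.d (i + 1) i c) →
        ∃ y, x = C.d (i + 1) i y) ∧
      (∀ i w, D.d i (i - 1) w = 0 → ∃ x, C.d i (i - 1) x = 0 ∧
        ∃ c, w = φ.f i x + D.d (i + 1) i c) := by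
  constructor
  · intro h
    refine ⟨fun i x hx => ?_, fun i w hw => ?_⟩
    · rintro ⟨c, hc⟩
      have h0 : φ.homologyMap i (Submodule.Quotient.mk ⟨x, hx⟩) = 0 := by
        rw [φ.homologyMap_mk i x hx (φ.mem_cycles hx)]
        exact (Submodule.Quotient.mk_eq_zero _).2 ⟨c, hc.symm⟩
      obtain ⟨y, hy⟩ := (Submodule.Quotient.mk_eq_zero _).1
        ((injective_iff_map_eq_zero _).1 (h i).1 _ h0)
      exact ⟨y, hy.symm⟩
    · obtain ⟨z, hz⟩ := (h i).2 (Submodule.Quotient.mk ⟨w, hw⟩)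
      obtain ⟨⟨x, hx⟩, rfl⟩ := Submodule.Quotient.mk_surjective _ z
      rw [φ.homologyMap_mk i x hx (φ.mem_cycles hx)] at hz
      obtain ⟨c, hc⟩ := (Submodule.Quotient.eq _).1 hz.symm
      refine ⟨x, hx, c, ?_⟩
      have hc' : D.d (i + 1) i c = w - φ.f i x := hc
      rw [hc']
      abel
  · rintro ⟨h₁, h₂⟩ i
    constructor
    · refine (injective_iff_map_eq_zero _).2 fun z hz => ?_
      obtain ⟨⟨x, hx⟩, rfl⟩ := Submodule.Quotient.mk_surjective _ z
      rw [φ.homologyMap_mk i x hx (φ.mem_cycles hx)] at hz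
      obtain ⟨c, hc⟩ := (Submodule.Quotient.mk_eq_zero _).1 hz
      obtain ⟨y, hy⟩ := h₁ i x hx ⟨c, hc.symm⟩
      exact (Submodule.Quotient.mk_eq_zero _).2 ⟨y, hy.symm⟩
    · intro z
      obtain ⟨⟨w, hw⟩, rfl⟩ := Submodule.Quotient.mk_surjective _ z
      obtain ⟨x, hx, c, hc⟩ := h₂ i w hw
      refine ⟨Submodule.Quotient.mk ⟨x, hx⟩, ?_⟩
      rw [φ.homologyMap_mk i x hx (φ.mem_cycles hx)]
      have hc' : D.d (i + 1) i c = w - φ.f i x := by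
        rw [hc]
        abel
      symm
      refine (Submodule.Quotient.eq _).2 ?_
      exact ⟨c, hc'⟩

theorem CxHom.isQuasiIso_id (C : Cx A) : (CxHom.id C).IsQuasiIso := by
  refine (CxHom.isQuasiIso_iff _).2 ⟨fun i x _ h => h, fun i w hw => ⟨w, hw, 0, ?_⟩⟩
  simp [CxHom.id]

theorem CxHom.IsQuasiIso.subsingleton_homology {C D : Cx A} {φ : CxHom C D}
    (h : φ.IsQuasiIso) (i : ℤ) [Subsingleton (D.homology i)] : Subsingleton (C.homology i) :=
  (h i).1.subsingleton

/-! ### Lifting along quasi-isomorphisms -/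

theorem exists_linearMap_of_relation {P Y : Type*} [AddCommGroup P] [Module A P]
    [AddCommGroup Y] [Module A Y] [Module.Projective A P] (T : Submodule A (P × Y))
    (h : ∀ x, ∃ y, (x, y) ∈ T) : ∃ f : P →ₗ[A] Y, ∀ x, (x, f x) ∈ T := by
  obtain ⟨g, hg⟩ := Module.projective_lifting_property
    ((LinearMap.fst A P Y).comp T.subtype) LinearMap.id (fun x => by
      obtain ⟨y, hy⟩ := h x
      exact ⟨⟨(x, y), hy⟩, rfl⟩)
  refine ⟨(LinearMap.snd A P Y).comp (T.subtype.comp g), fun x => ?_⟩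
  have hx : (g x).1.1 = x := LinearMap.congr_fun hg x
  have : (x, (g x).1.2) = (g x).1 := Prod.ext hx.symm rfl
  simp only [LinearMap.comp_apply, Submodule.subtype_apply, LinearMap.snd_apply]
  rw [this]
  exact (g x).2

/-- Dependent choice along the integers, for a relation that is automatic in low degrees. -/
theorem exists_int_family {T : ℤ → Type*} (good : ∀ i, T i → Prop)
    (R : ∀ i, T i → T (i + 1) → Prop) (n : ℤ) (hlow : ∀ i, i ≤ n → ∃ t, good i t)
    (hR : ∀ i, i < n → ∀ t t', R i t t')
    (step : ∀ i t, good i t → ∃ t', good (i + 1) t' ∧ R i t t') :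
    ∃ f : ∀ i, T i, ∀ i, R i (f i) (f (i + 1)) := by
  choose low hlow using hlow
  choose next hgood hnext using step
  let F : ∀ i, {t : T i // good i t} := fun i =>
    Int.inductionOn' i n ⟨low n le_rfl, hlow n le_rfl⟩
      (fun k _ t => ⟨next k t.1 t.2, hgood k t.1 t.2⟩)
      (fun k hk _ => ⟨low (k - 1) (by omega), hlow (k - 1) (by omega)⟩)
  refine ⟨fun i => (F i).1, fun i => ?_⟩
  rcases lt_or_ge i n with h | h
  · exact hR i h _ _
  · have : F (i + 1) = ⟨next i (F i).1 (F i).2, hgood i (F i).1 (F i).2⟩ :=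
      Int.inductionOn'_add_one h
    change R i (F i).1 (F (i + 1)).1
    rw [this]
    exact hnext i _ _

/-- A family of maps `P i → C (i + 1)` is a homotopy from `β` to `α` (in positive form). -/
def IsHtpy {P C : Cx A} (α β : CxHom P C) (s : ∀ i : ℤ, P.X i →ₗ[A] C.X (i + 1)) : Prop :=
  ∀ i x, α.f (i + 1) x = β.f (i + 1) x + C.d (i + 1 + 1) (i + 1) (s (i + 1) x) +
    s i (P.d (i + 1) i x)

/-- Composition of chain maps. -/
def CxHom.comp {C D E : Cx A} (ψ : CxHom D E) (φ : CxHom C D) : CxHom C E where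
  f i := (ψ.f i).comp (φ.f i)
  comm i j := by
    ext x
    simp [CxHom.comm_apply]

theorem CxHom.exists_lift {P F C : Cx A} (hP : ∃ n₀ : ℤ, ∀ i, i < n₀ → Subsingleton (P.X i))
    (hproj : ∀ i, Module.Projective A (P.X i)) (α : CxHom P C) (q : CxHom F C)
    (hq : q.IsQuasiIso) : ∃ (β : CxHom P F) (s : _), IsHtpy α (q.comp β) s := by
  obtain ⟨n₀, hn₀⟩ := hP
  obtain ⟨hinj, hsurj⟩ := q.isQuasiIso_iff.1 hq
  obtain ⟨f, hf⟩ := exists_int_family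
    (T := fun i => (P.X i →ₗ[A] F.X i) × (P.X i →ₗ[A] C.X (i + 1)))
    (good := fun i t => ∀ x, F.d i (i - 1) (t.1 (P.d (i + 1) i x)) = 0 ∧
      α.f i (P.d (i + 1) i x) = q.f i (t.1 (P.d (i + 1) i x)) +
        C.d (i + 1) i (t.2 (P.d (i + 1) i x)))
    (R := fun i t t' => ∀ x, F.d (i + 1) i (t'.1 x) = t.1 (P.d (i + 1) i x) ∧
      α.f (i + 1) x = q.f (i + 1) (t'.1 x) + C.d (i + 1 + 1) (i + 1) (t'.2 x) +
        t.2 (P.d (i + 1) i x)) (n₀ - 1)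
    (fun i hi => ⟨0, fun x => by
      have := hn₀ i (by omega)
      simp [Subsingleton.elim (P.d (i + 1) i x) 0]⟩)
    (fun i hi t t' x => by
      have := hn₀ (i + 1) (by omega)
      simp [Subsingleton.elim x 0])
    (fun i t ht => by
      let T : Submodule A (P.X (i + 1) × (F.X (i + 1) × C.X (i + 1 + 1))) :=
        { carrier := {p | F.d (i + 1) i p.2.1 = t.1 (P.d (i + 1) i p.1) ∧
            α.f (i + 1) p.1 = q.f (i + 1) p.2.1 + C.d (i + 1 + 1) (i + 1) p.2.2 +
              t.2 (P.d (i + 1) i p.1)}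
          zero_mem' := by simp
          add_mem' := by
            rintro ⟨x, y, c⟩ ⟨x', y', c'⟩ ⟨h₁, h₂⟩ ⟨h₁', h₂'⟩
            dsimp only at h₁ h₂ h₁' h₂'
            refine ⟨?_, ?_⟩
            · simp [h₁, h₁']
            · simp only [Prod.mk_add_mk, map_add, h₂, h₂']
              abel
          smul_mem' := by
            rintro a ⟨x, y, c⟩ ⟨h₁, h₂⟩
            dsimp only at h₁ h₂
            refine ⟨?_, ?_⟩
            · simp [h₁]
            · simp [h₂] }
      obtain ⟨g, hg⟩ := exists_linearMap_of_relation T (fun x => by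
        obtain ⟨h₁, h₂⟩ := ht x
        obtain ⟨y₀, hy₀⟩ := hinj i _ h₁ ⟨α.f (i + 1) x - t.2 (P.d (i + 1) i x), by
          rw [map_sub, α.comm_apply, h₂]
          abel⟩
        obtain ⟨y₁, hy₁, c, hc⟩ := hsurj (i + 1)
          (α.f (i + 1) x - q.f (i + 1) y₀ - t.2 (P.d (i + 1) i x)) (by
            have : ∀ k, k = i → C.d (i + 1) k
                (α.f (i + 1) x - q.f (i + 1) y₀ - t.2 (P.d (i + 1) i x)) = 0 := by
              rintro k rfl
              rw [map_sub, map_sub, α.comm_apply, q.comm_apply, ← hy₀, h₂]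
              abel
            exact this _ (by omega))
        refine ⟨(y₀ + y₁, c), ?_, ?_⟩
        · have : ∀ k, k = i + 1 - 1 → F.d (i + 1) k y₁ = 0 := by
            rintro k rfl
            exact hy₁
          simp only [map_add]
          rw [this i (by omega), add_zero, hy₀]
        · simp only [map_add]
          rw [add_assoc (q.f (i + 1) y₀), ← hc]
          abel)
      refine ⟨((LinearMap.fst A _ _).comp g, (LinearMap.snd A _ _).comp g), fun x => ?_,
        fun x => hg x⟩
      obtain ⟨h₁, h₂⟩ := hg (P.d (i + 1 + 1) (i + 1) x)
      dsimp only at h₁ h₂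
      rw [P.d_d, map_zero] at h₁ h₂
      rw [add_zero] at h₂
      refine ⟨?_, h₂⟩
      have : ∀ k, k = i → F.d (i + 1) k (g (P.d (i + 1 + 1) (i + 1) x)).1 = 0 := by
        rintro k rfl
        exact h₁
      exact this _ (by omega))
  exact ⟨CxHom.mk' (fun i => (f i).1) fun i x => (hf i x).1, fun i => (f i).2,
    fun i x => (hf i x).2⟩

theorem IsHtpy.apply {P C : Cx A} {α β : CxHom P C} {s : ∀ i : ℤ, P.X i →ₗ[A] C.X (i + 1)}
    (h : IsHtpy α β s) {i j : ℤ} (hij : i = j + 1) :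
    ∃ s' : P.X j →ₗ[A] C.X i, ∀ x, α.f i x = β.f i x + C.d (i + 1) i (s i x) +
      s' (P.d i j x) := by
  subst hij
  exact ⟨s j, h j⟩

theorem IsHtpy.isQuasiIso_of_comp {P F C : Cx A} {α : CxHom P C} {q : CxHom F C}
    {β : CxHom P F} {s : ∀ i : ℤ, P.X i →ₗ[A] C.X (i + 1)} (h : IsHtpy α (q.comp β) s)
    (hα : α.IsQuasiIso) (hq : q.IsQuasiIso) : β.IsQuasiIso := by
  obtain ⟨hα₁, hα₂⟩ := α.isQuasiIso_iff.1 hα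
  obtain ⟨hq₁, hq₂⟩ := q.isQuasiIso_iff.1 hq
  have key : ∀ i x, P.d i (i - 1) x = 0 →
      α.f i x = q.f i (β.f i x) + C.d (i + 1) i (s i x) := by
    intro i x hx
    obtain ⟨s', hs'⟩ := h.apply (i := i) (j := i - 1) (by omega)
    rw [hs', hx, map_zero, add_zero]
    rfl
  refine β.isQuasiIso_iff.2 ⟨fun i x hx => ?_, fun i w hw => ?_⟩
  · rintro ⟨c, hc⟩
    refine hα₁ i x hx ⟨q.f (i + 1) c + s i x, ?_⟩
    rw [key i x hx, hc, map_add, q.comm_apply]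
  · have hqw : C.d i (i - 1) (q.f i w) = 0 := by rw [q.comm_apply, hw, map_zero]
    obtain ⟨x, hx, c, hc⟩ := hα₂ i _ hqw
    obtain ⟨y, hy⟩ := hq₁ i (w - β.f i x)
      (by rw [map_sub, hw, β.comm_apply, hx, map_zero, sub_zero]) ⟨s i x + c, by
        rw [map_sub, hc, key i x hx, map_add]
        abel⟩
    exact ⟨x, hx, y, by rw [← hy]; abel⟩

/-- Two bounded below complexes of projectives that are quasi-isomorphic to the same complex
are related by a map with a left and a right homotopy inverse. -/
theorem exists_htpy_inverses {F G C : Cx A}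
    (hF : ∃ n₀ : ℤ, ∀ i, i < n₀ → Subsingleton (F.X i))
    (hFp : ∀ i, Module.Projective A (F.X i))
    (hG : ∃ n₀ : ℤ, ∀ i, i < n₀ → Subsingleton (G.X i))
    (hGp : ∀ i, Module.Projective A (G.X i))
    (p : CxHom F C) (hp : p.IsQuasiIso) (q : CxHom G C) (hq : q.IsQuasiIso) :
    ∃ (γ : CxHom F G) (β δ : CxHom G F) (s t : _),
      IsHtpy (CxHom.id F) (β.comp γ) s ∧ IsHtpy (CxHom.id G) (γ.comp δ) t := by
  obtain ⟨β, s₀, hs₀⟩ := CxHom.exists_lift hG hGp q p hp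
  have hβ := hs₀.isQuasiIso_of_comp hq hp
  obtain ⟨γ, s, hs⟩ := CxHom.exists_lift hF hFp (CxHom.id F) β hβ
  have hγ := hs.isQuasiIso_of_comp (CxHom.isQuasiIso_id F) hβ
  obtain ⟨δ, t, ht⟩ := CxHom.exists_lift hG hGp (CxHom.id G) γ hγ
  exact ⟨γ, β, δ, s, t, hs, ht⟩

/-! ### Nakayama-type arguments -/

theorem LinearMap.map_mem_smul_top {M N : Type*} [AddCommGroup M] [Module A M]
    [AddCommGroup N] [Module A N] {I : Ideal A} (f : M →ₗ[A] N) {x : M}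
    (hx : x ∈ I • (⊤ : Submodule A M)) : f x ∈ I • (⊤ : Submodule A N) :=
  Submodule.smul_top_le_comap_smul_top I f hx

theorem LinearMap.surjective_of_sub_mem_smul [IsLocalRing A] {M N : Type*} [AddCommGroup M]
    [Module A M] [AddCommGroup N] [Module A N] [Module.Finite A N] (f : M →ₗ[A] N)
    (h : ∀ y, ∃ x, y - f x ∈ (maximalIdeal A) • (⊤ : Submodule A N)) :
    Function.Surjective f := by
  rw [← LinearMap.range_eq_top, eq_top_iff]
  refine Submodule.le_of_le_smul_of_le_jacobson_bot (I := maximalIdeal A)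
    Module.Finite.fg_top (maximalIdeal_le_jacobson _) fun y _ => ?_
  obtain ⟨x, hx⟩ := h y
  rw [← add_sub_cancel (f x) y]
  exact Submodule.add_mem_sup ⟨x, rfl⟩ hx

theorem LinearMap.bijective_of_surjective_of_finrank_eq [IsLocalRing A] {M N : Type*}
    [AddCommGroup M] [Module A M] [AddCommGroup N] [Module A N] [Module.Free A M]
    [Module.Finite A M] [Module.Free A N] [Module.Finite A N] (f : M →ₗ[A] N)
    (hf : Function.Surjective f) (h : Module.finrank A M = Module.finrank A N) :
    Function.Bijective f := by
  let e := LinearEquiv.ofFinrankEq M N h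
  have := OrzechProperty.injective_of_surjective_endomorphism
    (e.symm.toLinearMap.comp f) (e.symm.surjective.comp hf)
  exact ⟨Function.Injective.of_comp this, hf⟩

/-- If `β ∘ γ` is bijective and `id - γ ∘ δ` factors through a projective module, then `γ`
embeds its source as a direct summand with projective complement. -/
theorem exists_projective_complement {M W H : Type u} [AddCommGroup M] [Module A M]
    [AddCommGroup W] [Module A W] [AddCommGroup H] [Module A H] [Module.Projective A H]
    [Module.Finite A W] (γ : M →ₗ[A] W) (β δ : W →ₗ[A] M) (a : W →ₗ[A] H) (b : H →ₗ[A] W)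
    (hβγ : Function.Bijective (β.comp γ)) (h : ∀ w, w = γ (δ w) + b (a w)) :
    ∃ (P : Type u) (_ : AddCommGroup P) (_ : Module A P), Module.Finite A P ∧
      Module.Projective A P ∧ Nonempty (W ≃ₗ[A] M × P) := by
  let e := LinearEquiv.ofBijective _ hβγ
  let σ : M →ₗ[A] W := γ.comp e.symm.toLinearMap
  have hβσ : ∀ m, β (σ m) = m := fun m => e.apply_symm_apply m
  have hσ : ∀ m, σ (β (γ m)) = γ m := fun m => congrArg γ (e.symm_apply_apply m)
  let π : W →ₗ[A] LinearMap.ker β := LinearMap.codRestrict _ (LinearMap.id - σ.comp β)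
    fun w => by simp [hβσ]
  have hπ : ∀ w, (π w : W) = w - σ (β w) := fun w => rfl
  have hπp : ∀ p : LinearMap.ker β, π p = p := fun p => by
    ext
    rw [hπ, LinearMap.mem_ker.1 p.2, map_zero, sub_zero]
  have hπγ : ∀ m, π (γ m) = 0 := fun m => by
    ext
    rw [hπ, hσ, sub_self]
    rfl
  refine ⟨LinearMap.ker β, inferInstance, inferInstance,
    Module.Finite.of_surjective π fun p => ⟨p, hπp p⟩,
    Module.Projective.of_split (a.comp (LinearMap.ker β).subtype) (π.comp b) ?_, ⟨?_⟩⟩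
  · ext p : 1
    have := congrArg π (h p)
    rw [map_add, hπγ, zero_add, hπp] at this
    exact this.symm
  · exact
    { toFun w := (β w, π w)
      map_add' x y := by simp
      map_smul' c x := by simp
      invFun p := σ p.1 + p.2
      left_inv w := by simp [hπ]
      right_inv p := by
        have hp : β (p.2 : W) = 0 := LinearMap.mem_ker.1 p.2.2
        refine Prod.ext ?_ (Subtype.ext ?_)
        · simp [hβσ, hp]
        · simp [hπ, hβσ, hp] }

/-! ### Cokernels of bounded below complexes of projectives -/

/-- The cokernel of the differential `C_{n+1} → C_n`. -/
abbrev Cx.coker (C : Cx A) (n : ℤ) : Type u := C.X n ⧸ LinearMap.range (C.d (n + 1) n)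

/-- The map induced by a chain map on cokernels of differentials. -/
def CxHom.cokerMap {C D : Cx A} (φ : CxHom C D) (n : ℤ) : C.coker n →ₗ[A] D.coker n :=
  Submodule.mapQ _ _ (φ.f n) (by
    rintro _ ⟨y, rfl⟩
    exact ⟨φ.f (n + 1) y, φ.comm_apply _ _ _⟩)

theorem Cx.coker_mk_d (C : Cx A) (n : ℤ) (x : C.X (n + 1)) :
    (Submodule.Quotient.mk (C.d (n + 1) n x) : C.coker n) = 0 :=
  (Submodule.Quotient.mk_eq_zero _).2 ⟨x, rfl⟩

section Local

variable [IsLocalRing A]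

theorem Cx.IsMinFree.sub_mem_of_isHtpy {F : Cx A} (hF : F.IsMinFree) {φ : CxHom F F}
    {s : ∀ i : ℤ, F.X i →ₗ[A] F.X (i + 1)} (h : IsHtpy (CxHom.id F) φ s) (i : ℤ) (x : F.X i) :
    x - φ.f i x ∈ (maximalIdeal A) • (⊤ : Submodule A (F.X i)) := by
  obtain ⟨s', hs'⟩ := h.apply (i := i) (j := i - 1) (by omega)
  have hx : x = φ.f i x + F.d (i + 1) i (s i x) + s' (F.d i (i - 1) x) := hs' x
  have : x - φ.f i x = F.d (i + 1) i (s i x) + s' (F.d i (i - 1) x) := by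
    rw [sub_eq_iff_eq_add]
    nth_rw 1 [hx]
    abel
  rw [this]
  exact add_mem (hF.2.2 _ _ _) (s'.map_mem_smul_top (hF.2.2 _ _ _))

theorem Cx.IsMinFree.projective {F : Cx A} (hF : F.IsMinFree) (i : ℤ) :
    Module.Projective A (F.X i) :=
  have := (hF.2.1 i).1
  inferInstance

/-- A minimal complex is degreewise a quotient of every other bounded below projective
complex quasi-isomorphic to the same complex. -/
theorem IsMinFreeResCx.exists_surjective {F G C : Cx A} (hF : IsMinFreeResCx F C)
    (hG : ∃ n₀ : ℤ, ∀ i, i < n₀ → Subsingleton (G.X i))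
    (hGp : ∀ i, Module.Projective A (G.X i)) (q : CxHom G C) (hq : q.IsQuasiIso) (i : ℤ) :
    ∃ f : G.X i →ₗ[A] F.X i, Function.Surjective f := by
  obtain ⟨hF, p, hp⟩ := hF
  obtain ⟨γ, β, δ, s, t, hs, ht⟩ := exists_htpy_inverses hF.1 hF.projective hG hGp p hp q hq
  have := (hF.2.1 i).2
  exact ⟨β.f i, LinearMap.surjective_of_sub_mem_smul _ fun y =>
    ⟨γ.f i y, hF.sub_mem_of_isHtpy hs i y⟩⟩

theorem IsMinFreeResCx.finrank_eq {F G C : Cx A} (hF : IsMinFreeResCx F C)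
    (hG : IsMinFreeResCx G C) (i : ℤ) :
    Module.finrank A (F.X i) = Module.finrank A (G.X i) := by
  have := (hF.1.2.1 i).2
  have := (hG.1.2.1 i).2
  obtain ⟨p, hp⟩ := hF.2
  obtain ⟨q, hq⟩ := hG.2
  obtain ⟨f, hf⟩ := hF.exists_surjective hG.1.1 hG.1.projective q hq i
  obtain ⟨g, hg⟩ := hG.exists_surjective hF.1.1 hF.1.projective p hp i
  exact le_antisymm (LinearMap.finrank_le_finrank_of_surjective hf)
    (LinearMap.finrank_le_finrank_of_surjective hg)

/-- The cokernels of a bounded below complex of finitely generated projectives are, up to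
free summands, those of its minimal free resolution. -/
theorem IsMinFreeResCx.exists_coker_equiv {F G C : Cx A}
    (hF : IsMinFreeResCx F C) (hG : ∃ n₀ : ℤ, ∀ i, i < n₀ → Subsingleton (G.X i))
    (hGp : ∀ i, Module.Projective A (G.X i)) (hGf : ∀ i, Module.Finite A (G.X i))
    (q : CxHom G C) (hq : q.IsQuasiIso) (n : ℤ) :
    ∃ (P : Type u) (_ : AddCommGroup P) (_ : Module A P), Module.Finite A P ∧
      Module.Free A P ∧ Nonempty (G.coker n ≃ₗ[A] F.coker n × P) := by
  obtain ⟨hF, p, hp⟩ := hF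
  obtain ⟨γ, β, δ, s, t, hs, ht⟩ := exists_htpy_inverses hF.1 hF.projective hG hGp p hp q hq
  obtain ⟨t', ht'⟩ := ht.apply (i := n) (j := n - 1) (by omega)
  have := (hF.2.1 n).2
  have := hGf n
  have := hGp (n - 1)
  have hbij : Function.Bijective ((β.cokerMap n).comp (γ.cokerMap n)) := by
    refine OrzechProperty.bijective_of_surjective_endomorphism _
      (LinearMap.surjective_of_sub_mem_smul _ fun y => ⟨y, ?_⟩)
    obtain ⟨y, rfl⟩ := Submodule.Quotient.mk_surjective _ y
    exact (Submodule.mkQ _).map_mem_smul_top (hF.sub_mem_of_isHtpy hs n y)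
  obtain ⟨P, _, _, hPf, hPp, ⟨e⟩⟩ := exists_projective_complement (γ.cokerMap n)
    (β.cokerMap n) (δ.cokerMap n)
    (Submodule.liftQ (LinearMap.range (G.d (n + 1) n)) (G.d n (n - 1)) (by
      rintro _ ⟨y, rfl⟩
      exact G.d_d _ _ _ y))
    ((Submodule.mkQ _).comp t') hbij (fun w => by
      obtain ⟨w, rfl⟩ := Submodule.Quotient.mk_surjective _ w
      have hw : w = γ.f n (δ.f n w) + G.d (n + 1) n (t n w) + t' (G.d n (n - 1) w) := ht' w
      have hw' := congrArg (Submodule.mkQ (LinearMap.range (G.d (n + 1) n))) hw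
      simp only [map_add, Submodule.mkQ_apply] at hw'
      rw [G.coker_mk_d, add_zero] at hw'
      exact hw')
  exact ⟨P, _, _, hPf, Module.free_of_flat_of_isLocalRing, ⟨e⟩⟩

/-! ### Minimal free resolutions of modules -/

/-- The minimal free resolution of the first syzygy obtained by truncation. -/
def MinFreeRes.tail {M : Type u} [AddCommGroup M] [Module A M] (R : MinFreeRes A M) :
    MinFreeRes A (LinearMap.ker R.aug) where
  F n := R.F (n + 1)
  free n := R.free (n + 1)
  fin n := R.fin (n + 1)
  d n := R.d (n + 1)
  aug := LinearMap.codRestrict _ (R.d 0) fun x => R.exact_aug.apply_apply_eq_zero x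
  aug_surj := by
    rintro ⟨x, hx⟩
    obtain ⟨y, hy⟩ := (R.exact_aug x).1 hx
    exact ⟨y, Subtype.ext hy⟩
  exact_aug := fun x => by
    rw [← R.exact_d 0 x]
    exact Subtype.ext_iff
  exact_d n := R.exact_d (n + 1)
  minimal n := R.minimal (n + 1)

theorem MinFreeRes.exists_lift {M M' : Type u} [AddCommGroup M] [Module A M]
    [AddCommGroup M'] [Module A M'] (e : M ≃ₗ[A] M') (R : MinFreeRes A M)
    (R' : MinFreeRes A M') :
    ∃ f : R.F 0 →ₗ[A] R'.F 0, (∀ x, R'.aug (f x) = e (R.aug x)) ∧ Function.Surjective f := by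
  have := R.free 0
  have := R'.fin 0
  obtain ⟨f, hf⟩ := Module.projective_lifting_property R'.aug (e.toLinearMap.comp R.aug)
    R'.aug_surj
  have hf' : ∀ x, R'.aug (f x) = e (R.aug x) := LinearMap.congr_fun hf
  refine ⟨f, hf', LinearMap.surjective_of_sub_mem_smul _ fun y => ?_⟩
  obtain ⟨x, hx⟩ := R.aug_surj (e.symm (R'.aug y))
  refine ⟨x, ?_⟩
  obtain ⟨z, hz⟩ := (R'.exact_aug (y - f x)).1 (by simp [hf', hx])
  rw [← hz]
  exact R'.minimal 0 z

theorem MinFreeRes.betti_eq (n : ℕ) : ∀ {M M' : Type u} [AddCommGroup M] [Module A M]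
    [AddCommGroup M'] [Module A M'] (_ : M ≃ₗ[A] M') (R : MinFreeRes A M)
    (R' : MinFreeRes A M'), R.betti n = R'.betti n := by
  induction n with
  | zero =>
    intro M M' _ _ _ _ e R R'
    have := R.fin 0
    have := R'.fin 0
    obtain ⟨f, -, hf⟩ := R.exists_lift e R'
    obtain ⟨g, -, hg⟩ := R'.exists_lift e.symm R
    exact le_antisymm (LinearMap.finrank_le_finrank_of_surjective hg)
      (LinearMap.finrank_le_finrank_of_surjective hf)
  | succ n ih =>
    intro M M' _ _ _ _ e R R'
    have := R.fin 0
    have := R'.fin 0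
    have := R.free 0
    have := R'.free 0
    obtain ⟨f, hfa, hf⟩ := R.exists_lift e R'
    obtain ⟨g, -, hg⟩ := R'.exists_lift e.symm R
    have hbij := f.bijective_of_surjective_of_finrank_eq hf
      (le_antisymm (LinearMap.finrank_le_finrank_of_surjective hg)
        (LinearMap.finrank_le_finrank_of_surjective hf))
    let u := LinearEquiv.ofBijective f hbij
    have hu : (LinearMap.ker R.aug).map (u : R.F 0 →ₗ[A] R'.F 0) = LinearMap.ker R'.aug := by
      ext y
      constructor
      · rintro ⟨x, hx, rfl⟩
        change R'.aug (f x) = 0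
        rw [hfa, LinearMap.mem_ker.1 hx, map_zero]
      · intro hy
        obtain ⟨x, rfl⟩ := hf y
        refine ⟨x, ?_, rfl⟩
        have : e (R.aug x) = 0 := by rw [← hfa]; exact hy
        exact e.map_eq_zero_iff.1 this
    exact ih (u.ofSubmodules _ _ hu) R.tail R'.tail


end Local

/-! ### Complexity -/

theorem CxBound.congr {β γ : ℕ → ℕ} {t : ℕ} (h : CxBound β t) (k : ℕ)
    (hk : ∀ n, k ≤ n → γ n = β n) : CxBound γ t := by
  obtain ⟨a, N, ha⟩ := h
  refine ⟨a, max N k, fun n hn => ?_⟩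
  rw [hk n (le_of_max_le_right hn)]
  exact ha n (le_of_max_le_left hn)

theorem Real.rpow_le_two_rpow_abs_mul {x y : ℝ} (hy : 0 < y) (h₁ : x ≤ 2 * y) (h₂ : y ≤ 2 * x)
    (r : ℝ) : x ^ r ≤ 2 ^ |r| * y ^ r := by
  rcases le_or_gt 0 r with hr | hr
  · rw [abs_of_nonneg hr, ← Real.mul_rpow (by norm_num) hy.le]
    exact Real.rpow_le_rpow (by linarith) h₁ hr
  · rw [abs_of_neg hr, Real.rpow_neg (by norm_num), ← Real.inv_rpow (by norm_num),
      ← Real.mul_rpow (by norm_num) hy.le]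
    exact Real.rpow_le_rpow_of_nonpos (by linarith) (by linarith) hr.le

theorem CxBound.shift {β : ℤ → ℕ} {k : ℤ} {t : ℕ} (h : CxBound (fun n => β (k + n)) t)
    (l : ℤ) : CxBound (fun n => β (l + n)) t := by
  obtain ⟨a, N, ha⟩ := h
  refine ⟨|a| * 2 ^ |(t : ℝ) - 1|, N + 2 * (l - k).natAbs + 1, fun n hn => ?_⟩
  obtain ⟨m, hm⟩ := Int.eq_ofNat_of_zero_le (a := l - k + n) (by omega)
  have hlm : l + n = k + m := by omega
  have h₁ : m ≤ 2 * n := by omega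
  have h₂ : n ≤ 2 * m := by omega
  have hpow := Real.rpow_le_two_rpow_abs_mul (x := m) (y := n)
    (by exact_mod_cast (by omega : 0 < n)) (by exact_mod_cast h₁) (by exact_mod_cast h₂)
    ((t : ℝ) - 1)
  change (β (l + n) : ℝ) ≤ _
  rw [hlm, mul_assoc]
  calc (β (k + m) : ℝ) ≤ a * (m : ℝ) ^ ((t : ℝ) - 1) := ha m (by omega)
    _ ≤ |a| * (m : ℝ) ^ ((t : ℝ) - 1) := by
      gcongr
      exact le_abs_self a
    _ ≤ _ := by gcongr

/-! ### Adding free summands -/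

/-- The module `Q` placed in degree zero. -/
def inDegreeZero (Q : ModuleCat.{u} A) : ℕ → ModuleCat.{u} A
  | 0 => Q
  | _ + 1 => ModuleCat.of A PUnit

instance (Q : ModuleCat.{u} A) (n : ℕ) : Subsingleton (inDegreeZero Q (n + 1)) :=
  inferInstanceAs (Subsingleton PUnit)

instance (Q : ModuleCat.{u} A) [h : Module.Free A Q] : ∀ n, Module.Free A (inDegreeZero Q n)
  | 0 => h
  | _ + 1 => inferInstanceAs (Module.Free A PUnit.{u + 1})

instance (Q : ModuleCat.{u} A) [h : Module.Finite A Q] :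
    ∀ n, Module.Finite A (inDegreeZero Q n)
  | 0 => h
  | _ + 1 => inferInstanceAs (Module.Finite A PUnit.{u + 1})

/-- The sum of an augmentation `F → M` with the identity of `Q`, for `N ≃ M × Q`. -/
def augAddFree {F M N : Type u} {Q : ModuleCat.{u} A} [AddCommGroup F] [Module A F]
    [AddCommGroup M] [Module A M] [AddCommGroup N] [Module A N] (aug : F →ₗ[A] M)
    (e : N ≃ₗ[A] M × Q) : F × inDegreeZero Q 0 →ₗ[A] N :=
  e.symm.toLinearMap.comp (aug.prodMap (LinearMap.id (M := Q)))

section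

variable {F₁ F M N : Type u} {Q : ModuleCat.{u} A} [AddCommGroup F₁] [Module A F₁]
  [AddCommGroup F] [Module A F] [AddCommGroup M] [Module A M] [AddCommGroup N] [Module A N]

theorem augAddFree_surjective {aug : F →ₗ[A] M} (e : N ≃ₗ[A] M × Q)
    (h : Function.Surjective aug) : Function.Surjective (augAddFree aug e) :=
  e.symm.surjective.comp (h.prodMap Function.surjective_id)

/-- A differential extended by zero. -/
def dAddFree (Q : ModuleCat.{u} A) (m n : ℕ) (d : F₁ →ₗ[A] F) :
    F₁ × inDegreeZero Q m →ₗ[A] F × inDegreeZero Q n :=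
  (LinearMap.inl A _ _).comp (d.comp (LinearMap.fst A _ _))

theorem dAddFree_apply (m n : ℕ) (d : F₁ →ₗ[A] F) (x : F₁ × inDegreeZero Q m) :
    dAddFree Q m n d x = (d x.1, 0) :=
  rfl

theorem exact_augAddFree {d : F₁ →ₗ[A] F} {aug : F →ₗ[A] M} (e : N ≃ₗ[A] M × Q) (m : ℕ)
    (h : Function.Exact d aug) : Function.Exact (dAddFree Q m 0 d) (augAddFree aug e) := by
  rintro ⟨x, q⟩
  constructor
  · intro hx
    have hx' : (aug x, q) = (0 : M × Q) := e.symm.map_eq_zero_iff.1 hx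
    obtain ⟨y, rfl⟩ := (h x).1 (congrArg Prod.fst hx')
    exact ⟨(y, 0), Prod.ext rfl (congrArg Prod.snd hx').symm⟩
  · rintro ⟨⟨y, q'⟩, hy⟩
    rw [← hy, dAddFree_apply]
    change e.symm (aug (d y), 0) = 0
    rw [h.apply_apply_eq_zero]
    exact e.symm.map_zero

theorem exact_dAddFree {d : F₁ →ₗ[A] F} {d' : F →ₗ[A] M} (l m n : ℕ)
    (h : Function.Exact d d') :
    Function.Exact (dAddFree Q l (m + 1) d) (dAddFree Q (m + 1) n d') := by
  rintro ⟨x, q⟩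
  constructor
  · intro hx
    obtain ⟨y, rfl⟩ := (h x).1 (congrArg Prod.fst hx)
    exact ⟨(y, 0), Prod.ext rfl (Subsingleton.elim _ _)⟩
  · rintro ⟨⟨y, q'⟩, hy⟩
    rw [← hy, dAddFree_apply, dAddFree_apply, h.apply_apply_eq_zero]
    rfl

end

/-- The sum of a finite resolution with a module placed in degree zero. -/
def FinRes.addFree {M N : Type u} {Q : ModuleCat.{u} A} [AddCommGroup M] [Module A M]
    [AddCommGroup N] [Module A N] (R : FinRes A M) (e : N ≃ₗ[A] M × Q) : FinRes A N where
  len := R.len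
  G n := ModuleCat.of A (R.G n × inDegreeZero Q n)
  d n := dAddFree Q (n + 1) n (R.d n)
  aug := augAddFree R.aug e
  bounded n hn := by
    obtain ⟨k, rfl⟩ := Nat.exists_eq_succ_of_ne_zero (Nat.ne_zero_of_lt hn)
    have := R.bounded _ hn
    exact inferInstanceAs (Subsingleton (R.G (k + 1) × inDegreeZero Q (k + 1)))
  aug_surj := augAddFree_surjective e R.aug_surj
  exact_aug := exact_augAddFree e _ R.exact_aug
  exact_d n := exact_dAddFree _ _ _ (R.exact_d n)

section Local

variable [IsLocalRing A]

/-- The sum of a minimal free resolution with a free module placed in degree zero. -/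
def MinFreeRes.addFree {M N : Type u} {Q : ModuleCat.{u} A} [AddCommGroup M] [Module A M]
    [AddCommGroup N] [Module A N] [Module.Free A Q] [Module.Finite A Q]
    (R : MinFreeRes A M) (e : N ≃ₗ[A] M × Q) : MinFreeRes A N where
  F n := ModuleCat.of A (R.F n × inDegreeZero Q n)
  free n :=
    have := R.free n
    inferInstanceAs (Module.Free A (R.F n × inDegreeZero Q n))
  fin n :=
    have := R.fin n
    inferInstanceAs (Module.Finite A (R.F n × inDegreeZero Q n))
  d n := dAddFree Q (n + 1) n (R.d n)
  aug := augAddFree R.aug e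
  aug_surj := augAddFree_surjective e R.aug_surj
  exact_aug := exact_augAddFree e _ R.exact_aug
  exact_d n := exact_dAddFree _ _ _ (R.exact_d n)
  minimal n x := (LinearMap.inl A (R.F n) (inDegreeZero Q n)).map_mem_smul_top (R.minimal n x.1)

theorem MinFreeRes.addFree_betti_succ {M N : Type u} {Q : ModuleCat.{u} A} [AddCommGroup M]
    [Module A M] [AddCommGroup N] [Module A N] [Module.Free A Q] [Module.Finite A Q]
    (R : MinFreeRes A M) (e : N ≃ₗ[A] M × Q) (n : ℕ) :
    (R.addFree e).betti (n + 1) = R.betti (n + 1) := by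
  have := R.free (n + 1)
  have := R.fin (n + 1)
  change Module.finrank A (R.F (n + 1) × inDegreeZero Q (n + 1)) = _
  rw [Module.finrank_prod, Module.finrank_zero_of_subsingleton (M := inDegreeZero Q (n + 1)),
    add_zero]
  rfl

theorem MinFreeRes.nonempty_of_complexity_ne_top {M : Type u} [AddCommGroup M] [Module A M]
    (h : complexity A M ≠ ⊤) : Nonempty (MinFreeRes A M) := by
  by_contra hM
  refine h (sInf_eq_top.2 ?_)
  rintro _ ⟨t, rfl, R, -⟩
  exact (hM ⟨R⟩).elim

theorem MinFreeRes.complexity_eq {M : Type u} [AddCommGroup M] [Module A M]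
    (R : MinFreeRes A M) :
    complexity A M = sInf {t : ℕ∞ | ∃ t' : ℕ, t = t' ∧ CxBound R.betti t'} := by
  rw [complexity]
  congr 1
  ext t
  refine exists_congr fun t' => and_congr_right fun _ => ⟨?_, fun h => ⟨R, h⟩⟩
  rintro ⟨R', h⟩
  exact h.congr 0 fun n _ => MinFreeRes.betti_eq n (LinearEquiv.refl A M) R R'

theorem MinFreeRes.complexity_addFree {M N : Type u} {Q : ModuleCat.{u} A} [AddCommGroup M]
    [Module A M] [AddCommGroup N] [Module A N] [Module.Free A Q] [Module.Finite A Q]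
    (R : MinFreeRes A M) (e : N ≃ₗ[A] M × Q) : complexity A N = complexity A M := by
  have hb : ∀ n, 1 ≤ n → (R.addFree e).betti n = R.betti n := by
    intro n hn
    obtain ⟨k, rfl⟩ := Nat.exists_eq_succ_of_ne_zero (Nat.ne_zero_of_lt hn)
    exact R.addFree_betti_succ e k
  rw [R.complexity_eq, (R.addFree e).complexity_eq]
  congr 1
  ext t
  exact exists_congr fun t' => and_congr_right fun _ =>
    ⟨fun h => h.congr 1 fun n hn => (hb n hn).symm, fun h => h.congr 1 hb⟩

theorem IsSyzygy.addFree {M N S : Type u} {Q : ModuleCat.{u} A} [AddCommGroup M]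
    [Module A M] [AddCommGroup N] [Module A N] [AddCommGroup S] [Module A S]
    [Module.Free A Q] [Module.Finite A Q] (e : N ≃ₗ[A] M × Q) {n : ℕ}
    (h : IsSyzygy A M S (n + 1)) : IsSyzygy A N S (n + 1) := by
  obtain ⟨R, ⟨u⟩⟩ := h
  refine ⟨R.addFree e, ⟨u.trans ((Submodule.equivMapOfInjective
    (LinearMap.inl A (R.F n) (inDegreeZero Q n)) LinearMap.inl_injective
    (LinearMap.range (R.d n))).trans (LinearEquiv.ofEq _ _ ?_))⟩⟩
  ext y
  constructor
  · rintro ⟨_, ⟨x, rfl⟩, rfl⟩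
    exact ⟨(x, 0), rfl⟩
  · rintro ⟨x, rfl⟩
    exact ⟨_, ⟨x.1, rfl⟩, rfl⟩

/-- Reductions of complexity are compatible with the addition of a free summand. -/
theorem ReducesWithDeg.addFree {M K : ModuleCat.{u} A} {t : ℕ} (h : ReducesWithDeg A M K t)
    {N Q : ModuleCat.{u} A} [Module.Free A Q] [Module.Finite A Q] (e : N ≃ₗ[A] M × Q) :
    ∃ Q' : ModuleCat.{u} A, Module.Free A Q' ∧ Module.Finite A Q' ∧
      ReducesWithDeg A N (ModuleCat.of A (K × Q')) t := by
  obtain ⟨ht, S, _, _, hS, f, g, hf, hg, hfg⟩ := h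
  obtain rfl | ⟨t, rfl⟩ : t = 1 ∨ ∃ s, t = s + 2 := by
    rcases t with _ | _ | s
    · omega
    · exact Or.inl rfl
    · exact Or.inr ⟨s, rfl⟩
  · obtain ⟨u⟩ := hS
    refine ⟨ModuleCat.of A (Q × Q), inferInstanceAs (Module.Free A (Q × Q)),
      inferInstanceAs (Module.Finite A (Q × Q)), ht, M × Q, inferInstance, inferInstance,
      ⟨e.symm⟩, (f.prodMap (LinearMap.inl A Q Q)).comp e.toLinearMap,
      (u.toLinearMap.comp g).prodMap (LinearMap.snd A Q Q), ?_, ?_, ?_⟩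
    · exact (hf.prodMap LinearMap.inl_injective).comp e.injective
    · exact (u.surjective.comp hg).prodMap (LinearMap.snd_surjective (R := A))
    · rintro ⟨k, q, q'⟩
      constructor
      · intro hk
        obtain ⟨m, rfl⟩ := (hfg k).1 (u.map_eq_zero_iff.1 (congrArg Prod.fst hk))
        refine ⟨e.symm (m, q), ?_⟩
        have hq : q' = 0 := congrArg Prod.snd hk
        simp [hq]
      · rintro ⟨n, hn⟩
        rw [← hn]
        simp [hfg.apply_apply_eq_zero]
  · refine ⟨Q, inferInstance, inferInstance, ht, S, _, _, hS.addFree e,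
      (f.prodMap (LinearMap.id (M := Q))).comp e.toLinearMap, g.comp (LinearMap.fst A K Q), ?_, ?_, ?_⟩
    · exact (hf.prodMap Function.injective_id).comp e.injective
    · exact hg.comp LinearMap.fst_surjective
    · rintro ⟨k, q⟩
      constructor
      · intro hk
        obtain ⟨m, rfl⟩ := (hfg k).1 hk
        refine ⟨e.symm (m, q), ?_⟩
        simp
      · rintro ⟨n, hn⟩
        rw [← hn]
        simp [hfg.apply_apply_eq_zero]

/-- Reducible complexity is preserved by isomorphisms and by adding free summands. -/
theorem HasRedCxCat.addFree {M : ModuleCat.{u} A} (h : HasRedCxCat A M) :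
    ∀ (N Q : ModuleCat.{u} A) [Module.Free A Q] [Module.Finite A Q] (_ : N ≃ₗ[A] M × Q),
      HasRedCxCat A N := by
  induction h with
  | of_finite_pd M h =>
    intro N Q _ _ e
    obtain ⟨R, hR⟩ := h
    refine .of_finite_pd N ⟨R.addFree e, fun n => ?_⟩
    have := hR n
    exact inferInstanceAs (Module.Projective A (R.G n × inDegreeZero Q n))
  | of_step M K t h₀ htop hred hlt _ ih =>
    intro N Q _ _ e
    obtain ⟨RM⟩ := MinFreeRes.nonempty_of_complexity_ne_top htop
    obtain ⟨RK⟩ := MinFreeRes.nonempty_of_complexity_ne_top hlt.ne_top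
    obtain ⟨Q', _, _, hred'⟩ := hred.addFree e
    have hN := RM.complexity_addFree e
    refine .of_step N _ t ?_ ?_ hred' ?_ (ih _ Q' (LinearEquiv.refl A (K × Q')))
    · rwa [hN]
    · rwa [hN]
    · rw [hN]
      exact (RK.complexity_addFree (LinearEquiv.refl A (K × Q'))).trans_lt hlt

end Local

/-! ### Cones -/

section Cone

variable {C D K : Cx A} {g : CxHom C D}

theorem IsConeOf.nonempty_equiv (h : IsConeOf g K) (i : ℤ) :
    Nonempty ((D.X i × C.X (i - 1)) ≃ₗ[A] K.X i) := by
  obtain ⟨ι, π, s, -, -, hι, hπι, hπs, hsum, -⟩ := h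
  have hπι : ∀ x, π i (ι i x) = 0 := LinearMap.congr_fun (hπι i)
  have hπs : ∀ x, π i (s i x) = x := LinearMap.congr_fun (hπs i)
  refine ⟨LinearEquiv.ofBijective ((ι i).coprod (s i)) ⟨?_, ?_⟩⟩
  · refine (injective_iff_map_eq_zero _).2 ?_
    rintro ⟨y, c⟩ hyc
    rw [LinearMap.coprod_apply] at hyc
    have hc : c = 0 := by
      have := congrArg (π i) hyc
      rwa [map_add, hπι, hπs, zero_add, map_zero] at this
    subst hc
    rw [map_zero, add_zero] at hyc
    have hy : y = 0 := hι i (hyc.trans (map_zero _).symm)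
    rw [hy]
    rfl
  · intro x
    obtain ⟨y, hy⟩ := hsum i x
    exact ⟨(y, π i x), hy.symm⟩

theorem IsConeOf.exists_lt_subsingleton (h : IsConeOf g K)
    (hC : ∃ n₀ : ℤ, ∀ i, i < n₀ → Subsingleton (C.X i))
    (hD : ∃ n₀ : ℤ, ∀ i, i < n₀ → Subsingleton (D.X i)) :
    ∃ n₀ : ℤ, ∀ i, i < n₀ → Subsingleton (K.X i) := by
  obtain ⟨a, ha⟩ := hC
  obtain ⟨b, hb⟩ := hD
  refine ⟨min a b, fun i hi => ?_⟩
  obtain ⟨e⟩ := h.nonempty_equiv i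
  have := ha (i - 1) (by omega)
  have := hb i (by omega)
  exact e.symm.toEquiv.subsingleton

/-- The long exact sequence of a cone gives vanishing of its homology. -/
theorem IsConeOf.subsingleton_homology (h : IsConeOf g K) {i : ℤ}
    (hC : Subsingleton (C.homology (i - 1))) (hD : Subsingleton (D.homology i)) :
    Subsingleton (K.homology i) := by
  obtain ⟨ι, π, s, hdι, hdπ, hι, hπι, hπs, hsum, -⟩ := h
  have hdι : ∀ i j x, K.d i j (ι i x) = ι j (D.d i j x) :=
    fun i j => LinearMap.congr_fun (hdι i j)
  have hdπ : ∀ i j x, π j (K.d i j x) = (-1 : A) • C.d (i - 1) (j - 1) (π i x) :=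
    fun i j => LinearMap.congr_fun (hdπ i j)
  have hπs : ∀ i x, π i (s i x) = x := fun i => LinearMap.congr_fun (hπs i)
  refine (K.subsingleton_homology_iff i).2 fun k hk => ?_
  obtain ⟨c, hc⟩ := Cx.exists_d_eq hC (i := i + 1 - 1) (k := i - 1 - 1) (by omega) rfl
    (x := π i k) (by
      have := hdπ i (i - 1) k
      rw [hk, map_zero, neg_one_smul, eq_comm, neg_eq_zero] at this
      exact this)
  obtain ⟨y, hy⟩ := hsum i (k + K.d (i + 1) i (s (i + 1) c))
  have hz : π i (k + K.d (i + 1) i (s (i + 1) c)) = 0 := by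
    rw [map_add, hdπ, hπs, hc, neg_one_smul, add_neg_cancel]
  rw [hz, map_zero, add_zero] at hy
  obtain ⟨z, hz⟩ := Cx.exists_d_eq hD (i := i + 1) (k := i - 1) rfl rfl (x := y) (by
    apply hι
    rw [← hdι, ← hy, map_add, hk, K.d_d, map_zero, add_zero])
  refine ⟨ι (i + 1) z - s (i + 1) c, ?_⟩
  rw [map_sub, hdι, hz, ← hy, add_sub_cancel_right]

/-- The cokernels of a cone form short exact sequences above the homology of the source. -/
theorem IsConeOf.exists_exact_coker (h : IsConeOf g K) {N : ℤ}
    (hC : Subsingleton (C.homology N)) :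
    ∃ (f : D.coker N →ₗ[A] K.coker N)
      (p : K.coker N →ₗ[A] C.X (N - 1) ⧸ LinearMap.range (C.d (N + 1 - 1) (N - 1))),
      Function.Injective f ∧ Function.Surjective p ∧ Function.Exact f p := by
  obtain ⟨ι, π, s, hdι, hdπ, hι, hπι, hπs, hsum, -⟩ := h
  have hdι : ∀ i j x, K.d i j (ι i x) = ι j (D.d i j x) :=
    fun i j => LinearMap.congr_fun (hdι i j)
  have hdπ : ∀ i j x, π j (K.d i j x) = (-1 : A) • C.d (i - 1) (j - 1) (π i x) :=
    fun i j => LinearMap.congr_fun (hdπ i j)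
  have hπs : ∀ i x, π i (s i x) = x := fun i => LinearMap.congr_fun (hπs i)
  have hπι : ∀ i x, π i (ι i x) = 0 := fun i => LinearMap.congr_fun (hπι i)
  have lift : ∀ i k (c : C.X (i + 1 - 1)), π i k = C.d (i + 1 - 1) (i - 1) c →
      ∃ y, k + K.d (i + 1) i (s (i + 1) c) = ι i y := by
    intro i k c hc
    obtain ⟨y, hy⟩ := hsum i (k + K.d (i + 1) i (s (i + 1) c))
    refine ⟨y, ?_⟩
    rwa [map_add (π i), hdπ, hπs, hc, neg_one_smul, add_neg_cancel, map_zero, add_zero] at hy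
  refine ⟨Submodule.mapQ _ _ (ι N) ?_, Submodule.mapQ _ _ (π N) ?_, ?_, ?_, ?_⟩
  · rintro _ ⟨y, rfl⟩
    exact ⟨ι (N + 1) y, hdι _ _ _⟩
  · rintro _ ⟨y, rfl⟩
    refine ⟨-π (N + 1) y, ?_⟩
    rw [hdπ, neg_one_smul, map_neg]
  · refine (injective_iff_map_eq_zero _).2 fun x hx => ?_
    obtain ⟨x, rfl⟩ := Submodule.Quotient.mk_surjective _ x
    obtain ⟨k, hk⟩ := (Submodule.Quotient.mk_eq_zero _).1 hx
    have hC' : Subsingleton (C.homology (N + 1 - 1)) := by rwa [add_sub_cancel_right]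
    obtain ⟨c, hc⟩ := Cx.exists_d_eq hC' (i := N + 1 + 1 - 1) (k := N - 1) (by omega)
      (by omega) (x := π (N + 1) k) (by
        have := hdπ (N + 1) N k
        rw [hk, hπι, neg_one_smul, eq_comm, neg_eq_zero] at this
        exact this)
    obtain ⟨y, hy⟩ := lift (N + 1) k c hc.symm
    refine (Submodule.Quotient.mk_eq_zero _).2 ⟨y, ?_⟩
    apply hι
    rw [← hdι, ← hy, map_add, hk, K.d_d, add_zero]
  · intro z
    obtain ⟨z, rfl⟩ := Submodule.Quotient.mk_surjective _ z
    exact ⟨Submodule.Quotient.mk (s N z), congrArg _ (hπs N z)⟩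
  · intro z
    obtain ⟨z, rfl⟩ := Submodule.Quotient.mk_surjective _ z
    constructor
    · intro hz
      obtain ⟨c, hc⟩ := (Submodule.Quotient.mk_eq_zero _).1 hz
      obtain ⟨y, hy⟩ := lift N z c hc.symm
      refine ⟨Submodule.Quotient.mk y, ?_⟩
      rw [Submodule.mapQ_apply, ← hy, Submodule.Quotient.mk_add, K.coker_mk_d, add_zero]
    · rintro ⟨y, hy⟩
      obtain ⟨y, rfl⟩ := Submodule.Quotient.mk_surjective _ y
      rw [← hy, Submodule.mapQ_apply, Submodule.mapQ_apply, hπι, Submodule.Quotient.mk_zero]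

end Cone

theorem Cx.shift_d_eq_zero_iff (C : Cx A) (t : ℕ) (i j : ℤ) (x : C.X (i - t)) :
    (C.shift t).d i j x = 0 ↔ C.d (i - t) (j - t) x = 0 :=
  ((isUnit_one (M := A)).neg.pow t).smul_eq_zero

theorem Cx.shift_range_d (C : Cx A) (t : ℕ) (i j : ℤ) :
    LinearMap.range ((C.shift t).d i j) = LinearMap.range (C.d (i - t) (j - t)) := by
  ext y
  constructor
  · rintro ⟨x, rfl⟩
    exact ⟨((-1 : A) ^ t) • x, map_smul _ _ _⟩
  · rintro ⟨x, rfl⟩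
    refine ⟨((-1 : A) ^ t) • x, ?_⟩
    change ((-1 : A) ^ t) • C.d (i - t) (j - t) (((-1 : A) ^ t) • x) = _
    rw [map_smul, smul_smul, ← mul_pow]
    simp

theorem Cx.subsingleton_homology_shift {C : Cx A} {t : ℕ} {i : ℤ}
    (h : Subsingleton (C.homology (i - t))) : Subsingleton ((C.shift t).homology i) := by
  refine ((C.shift t).subsingleton_homology_iff i).2 fun x hx => ?_
  obtain ⟨y, hy⟩ := Cx.exists_d_eq h (i := i + 1 - t) (k := i - 1 - t) (by omega) (by omega)
    ((C.shift_d_eq_zero_iff t i (i - 1) x).1 hx)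
  have : x ∈ LinearMap.range ((C.shift t).d (i + 1) i) := by
    rw [C.shift_range_d]
    exact ⟨y, hy⟩
  exact this

theorem Cx.nonempty_coker_equiv (C : Cx A) {i j m : ℤ} (hij : i = j + 1) (hj : j = m) :
    Nonempty ((C.X j ⧸ LinearMap.range (C.d i j)) ≃ₗ[A] C.coker m) := by
  subst hij hj
  exact ⟨LinearEquiv.refl A _⟩

theorem Cx.nonempty_shift_coker_equiv (C : Cx A) (t : ℕ) {i m : ℤ} (h : i = m + t) :
    Nonempty ((C.shift t).coker i ≃ₗ[A] C.coker m) := by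
  obtain ⟨e⟩ := C.nonempty_coker_equiv (i := i + 1 - t) (j := i - t) (m := m)
    (by omega) (by omega)
  have e₁ : (C.shift t).coker i ≃ₗ[A]
      (C.X (i - t) ⧸ LinearMap.range (C.d (i + 1 - t) (i - t))) :=
    Submodule.quotEquivOfEq (M := C.X (i - t)) _ _ (C.shift_range_d t (i + 1) i)
  exact ⟨e₁.trans e⟩

/-- Above the homology, a cokernel is isomorphic to the image of the next differential. -/
theorem Cx.nonempty_coker_equiv_range {C : Cx A} {i j k : ℤ} (h : Subsingleton (C.homology j))
    (hi : i = j + 1) (hk : k = j - 1) :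
    Nonempty ((C.X j ⧸ LinearMap.range (C.d i j)) ≃ₗ[A] LinearMap.range (C.d j k)) := by
  have : LinearMap.range (C.d i j) = LinearMap.ker (C.d j k) := by
    ext x
    constructor
    · rintro ⟨y, rfl⟩
      exact C.d_d _ _ _ y
    · exact fun hx => Cx.exists_d_eq h hi hk hx
  rw [this]
  exact ⟨(C.d j k).quotKerEquivRange⟩

section Local

variable [IsLocalRing A]

/-! ### Truncations of minimal complexes -/

/-- The truncation of a minimal complex above its homology is a minimal free resolution. -/
def Cx.IsMinFree.truncRes {F : Cx A} (hF : F.IsMinFree) {n : ℤ}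
    (h : ∀ i, n < i → Subsingleton (F.homology i)) : MinFreeRes A (F.coker n) :=
  let e : (F.X (n + (0 : ℕ)) ⧸ LinearMap.range (F.d (n + (0 + 1 : ℕ)) (n + (0 : ℕ))))
      ≃ₗ[A] F.coker n := (F.nonempty_coker_equiv (by omega) (by omega)).some
  { F k := F.X (n + k)
    free k := (hF.2.1 _).1
    fin k := (hF.2.1 _).2
    d k := F.d (n + (k + 1 : ℕ)) (n + k)
    aug := e.toLinearMap.comp (Submodule.mkQ _)
    aug_surj := e.surjective.comp (Submodule.mkQ_surjective _)
    exact_aug x := by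
      rw [LinearMap.comp_apply, LinearEquiv.coe_coe, e.map_eq_zero_iff]
      exact Submodule.Quotient.mk_eq_zero _
    exact_d k x := by
      refine ⟨fun hx => ?_, ?_⟩
      · exact Cx.exists_d_eq (h (n + (k + 1 : ℕ)) (by omega)) (by omega) (by omega) hx
      · rintro ⟨y, rfl⟩
        exact F.d_d _ _ _ y
    minimal k x := hF.2.2 _ _ x }

theorem IsMinFreeResCx.subsingleton_homology {F C : Cx A} (hF : IsMinFreeResCx F C) {n : ℤ}
    (h : ∀ i, n < i → Subsingleton (C.homology i)) (i : ℤ) (hi : n < i) :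
    Subsingleton (F.homology i) := by
  obtain ⟨p, hp⟩ := hF.2
  have := h i hi
  exact hp.subsingleton_homology i

/-- The complexity of a complex is that of the cokernels of its minimal free resolution. -/
theorem IsMinFreeResCx.complexity_coker {F C : Cx A} (hF : IsMinFreeResCx F C) {n : ℤ}
    (h : ∀ i, n < i → Subsingleton (C.homology i)) :
    complexity A (F.coker n) = cxComplexity A C := by
  rw [(hF.1.truncRes (hF.subsingleton_homology h)).complexity_eq, cxComplexity]
  congr 1
  ext t
  refine exists_congr fun t' => and_congr_right fun _ => ⟨fun hb => ⟨F, hF, ?_⟩, ?_⟩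
  · exact (CxBound.shift (β := fun i => Module.finrank A (F.X i)) (k := n) hb 0).congr 0
      fun k _ => by rw [zero_add]
  · rintro ⟨G, hG, hb⟩
    exact CxBound.shift (β := fun i => Module.finrank A (F.X i)) (k := 0) (hb.congr 0
      fun k _ => by rw [zero_add, hF.finrank_eq hG]) n

theorem IsMinFreeResCx.hasFiniteProjDim_coker {F C : Cx A} (hF : IsMinFreeResCx F C) {n : ℤ}
    (h : ∀ i, n < i → Subsingleton (C.homology i)) (hC : C.HasFinitePD) :
    HasFiniteProjDim A (F.coker n) := by
  obtain ⟨P, ⟨⟨a, b, hab⟩, hP⟩, q, hq⟩ := hC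
  let R := hF.1.truncRes (hF.subsingleton_homology h)
  refine ⟨⟨(b - n).toNat, R.F, R.d, R.aug, fun k hk => ?_, R.aug_surj, R.exact_aug,
    R.exact_d⟩, fun k => hF.1.projective _⟩
  obtain ⟨f, hf⟩ := hF.exists_surjective ⟨a, fun i hi => hab i (Or.inl hi)⟩
    (fun i => (hP i).2) q hq (n + k)
  have := hab (n + k) (Or.inr (by omega))
  exact hf.subsingleton

theorem Cx.IsMinFree.isSyzygy_coker {F : Cx A} (hF : F.IsMinFree) {n : ℤ}
    (h : ∀ i, n < i → Subsingleton (F.homology i)) {i j : ℤ} (t : ℕ) (hj : j = n + t)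
    (hi : i = j + 1) :
    IsSyzygy A (F.coker n) (F.X j ⧸ LinearMap.range (F.d i j)) t := by
  subst hj
  cases t with
  | zero => exact F.nonempty_coker_equiv hi (by simp)
  | succ t =>
    exact ⟨hF.truncRes h, Cx.nonempty_coker_equiv_range (h _ (by omega)) hi (by omega)⟩

theorem CxRedCx.hasRedCxCat_coker {C : Cx A} (hC : CxRedCx A C) :
    ∀ (F : Cx A), IsMinFreeResCx F C → ∀ n : ℤ,
      (∀ i, n < i → Subsingleton (C.homology i)) →
        HasRedCxCat A (ModuleCat.of A (F.coker n)) := by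
  induction hC with
  | of_finite_pd C hC =>
    exact fun F hF n h => .of_finite_pd _ (hF.hasFiniteProjDim_coker h hC)
  | of_step C t F₀ g K ht h₀ htop hF₀ hcone hlt _ ih =>
    intro F hF n h
    have hH := hF₀.subsingleton_homology h
    have hHs : ∀ i, n + t < i → Subsingleton ((F₀.shift t).homology i) := fun i hi =>
      Cx.subsingleton_homology_shift (hH _ (by omega))
    have hHK : ∀ i, n + t < i → Subsingleton (K.homology i) := fun i hi =>
      hcone.subsingleton_homology (hH _ (by omega)) (hHs i hi)
    obtain ⟨K', hK'⟩ : ∃ K', IsMinFreeResCx K' K := by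
      by_contra hK
      refine hlt.ne_top (sInf_eq_top.2 ?_)
      rintro _ ⟨t, rfl, K', hK', -⟩
      exact (hK ⟨K', hK'⟩).elim
    have hKb := hcone.exists_lt_subsingleton hF₀.1.1 (by
      obtain ⟨a, ha⟩ := hF₀.1.1
      exact ⟨a + t, fun i hi => ha (i - t) (by omega)⟩)
    have hKfp : ∀ i, Module.Projective A (K.X i) ∧ Module.Finite A (K.X i) := fun i => by
      obtain ⟨e⟩ := hcone.nonempty_equiv i
      obtain ⟨_, _⟩ : Module.Free A ((F₀.shift t).X i) ∧ Module.Finite A ((F₀.shift t).X i) :=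
        hF₀.1.2.1 (i - t)
      obtain ⟨_, _⟩ := hF₀.1.2.1 (i - 1)
      exact ⟨Module.Projective.of_equiv e, Module.Finite.equiv e⟩
    obtain ⟨P, _, _, _, _, ⟨eK⟩⟩ := hK'.exists_coker_equiv hKb (fun i => (hKfp i).1)
      (fun i => (hKfp i).2) (CxHom.id K) (CxHom.isQuasiIso_id K) (n + t)
    have hredK : HasRedCxCat A (ModuleCat.of A (K.coker (n + t))) :=
      (ih K' hK' (n + t) hHK).addFree _ (ModuleCat.of A P) eK
    have hcxK : complexity A (K.coker (n + t)) = cxComplexity A K :=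
      ((hK'.1.truncRes (hK'.subsingleton_homology hHK)).complexity_addFree
        (Q := ModuleCat.of A P) eK).trans (hK'.complexity_coker hHK)
    have hcx := hF₀.complexity_coker h
    obtain ⟨f, p, hf, hp, hfp⟩ := hcone.exists_exact_coker (hH (n + t) (by omega))
    obtain ⟨e⟩ := F₀.nonempty_shift_coker_equiv t (rfl : n + t = n + t)
    have hred : HasRedCxCat A (ModuleCat.of A (F₀.coker n)) := by
      refine .of_step _ (ModuleCat.of A (K.coker (n + t))) t (by rwa [← hcx] at h₀)
        (by rwa [← hcx] at htop) ⟨ht, _, _, _,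
          hF₀.1.isSyzygy_coker hH (t - 1) (by omega) (by omega),
          f.comp e.symm.toLinearMap, p, hf.comp e.symm.injective, hp, fun x => ?_⟩ ?_ hredK
      · rw [hfp x]
        exact e.symm.surjective.range_comp f ▸ Iff.rfl
      · exact (hcxK.trans_lt hlt).trans_eq hcx.symm
    obtain ⟨q, hq⟩ := hF.2
    obtain ⟨Q, _, _, _, _, ⟨eF⟩⟩ := hF₀.exists_coker_equiv hF.1.1 hF.1.projective
      (fun i => (hF.1.2.1 i).2) q hq n
    exact hred.addFree _ (ModuleCat.of A Q) eF

end Local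

/-- **Proposition 4.2.** Let `C` be a homologically finite complex of `A`-modules having
reducible complexity, let `n = sup C`, and let `F` be a minimal complex of finitely
generated free `A`-modules quasi-isomorphic to `C`. Then the `A`-module
`M = Coker(F_{n+1} → F_n)` has reducible complexity. -/
theorem cokernel_has_reducible_complexity (A : Type u) [CommRing A] [IsNoetherianRing A]
    [IsLocalRing A]
    (C : Cx A) (hhf : C.HomFinite) (hred : CxRedCx A C)
    (F : Cx A) (hF : IsMinFreeResCx F C)
    (n : ℤ) (hn : ¬ Subsingleton (C.homology n))
    (hsup : ∀ i : ℤ, n < i → Subsingleton (C.homology i)) :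
    HasReducibleComplexity A (F.X n ⧸ LinearMap.range (F.d (n + 1) n)) := by
  exact hred.hasRedCxCat_coker F hF n hsup
end
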